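/- For every constant C > 0 there exists n₀ such that for all n ≥ n₀ and all integers r with 2 ≤ r ≤ C·√(ln ln n): every n-uniform hypergraph whose chromatic number is greater than r has at least e^{−4r²} · (n/ln n)^{a/(a+1)} · r^n edges, where a = ⌊log₂ r⌋; that is, m(n,r) ≥ e^{−4r²} · (n/ln n)^{a/(a+1)} · r^n. -/

import Mathlib

section Aux
open Finset

def IsCh {V K : Type*} [LinearOrder K] (k : V → K) (A : ℕ → Finset V) (w : ℕ → V) (j : ℕ) : Prop :=
  ∀ i < j, w i ∈ A i ∧ w (i+1) ∈ A i ∧ ∀ x ∈ A i, k (w i) ≤ k x ∧ k x ≤ k (w (i+1))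

/-- Greedy colouring (Pluhar): not `r`-colourable implies an ordered `r`-chain. -/
theorem exists_chain {V K : Type*} [LinearOrder K] (k : V → K) (E : Finset (Finset V)) (r : ℕ)
    (hne : ∀ A ∈ E, A.Nonempty)
    (hcol : ∀ c : V → Fin r, ∃ A ∈ E, ∃ i : Fin r, ∀ v ∈ A, c v = i) :
    ∃ A w, (∀ i < r, A i ∈ E) ∧ IsCh k A w r := by
  classical
  by_contra hcon
  let P : V → ℕ → Prop := fun v j => ∃ A w, w j = v ∧ (∀ i < j, A i ∈ E) ∧ IsCh k A w j
  have hP0 : ∀ v, P v 0 := fun v => ⟨fun _ => ∅, fun _ => v, rfl, by simp, by simp [IsCh]⟩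
  have hPr : ∀ v, ¬ P v r := fun v ⟨A, w, _, h1, h2⟩ => hcon ⟨A, w, h1, h2⟩
  let c : V → ℕ := fun v => Nat.findGreatest (P v) r
  have hPc : ∀ v, P v (c v) := fun v => Nat.findGreatest_spec (Nat.zero_le r) (hP0 v)
  have hcr : ∀ v, c v < r := by
    intro v
    refine lt_of_le_of_ne (Nat.findGreatest_le r) ?_
    intro h
    have := hPc v
    rw [h] at this
    exact hPr v this
  obtain ⟨A, hA, i, hi⟩ := hcol (fun v => ⟨c v, hcr v⟩)
  obtain ⟨u, hu, hu'⟩ := exists_min_image A k (hne A hA)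
  obtain ⟨v, hv, hv'⟩ := exists_max_image A k (hne A hA)
  have hcu : c u = i := congrArg Fin.val (hi u hu)
  have hcv : c v = i := congrArg Fin.val (hi v hv)
  have hext : P v (i + 1) := by
    obtain ⟨B, w, h0, h1, h2⟩ := hPc u
    rw [hcu] at h0 h1 h2
    refine ⟨Function.update B i A, Function.update w (i+1) v, by simp, ?_, ?_⟩
    · intro j hj
      rcases Nat.lt_succ_iff_lt_or_eq.1 hj with h | h
      · rw [Function.update_of_ne h.ne]; exact h1 j h
      · subst h; simpa using hA
    · intro j hj
      rcases Nat.lt_succ_iff_lt_or_eq.1 hj with h | h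
      · rw [Function.update_of_ne h.ne, Function.update_of_ne (by omega),
          Function.update_of_ne (by omega)]
        exact h2 j h
      · subst h
        rw [Function.update_self, Function.update_self, Function.update_of_ne (by omega), h0]
        exact ⟨hu, hv, fun x hx => ⟨hu' x hx, hv' x hx⟩⟩
  have : (i : ℕ) + 1 ≤ c v := Nat.le_findGreatest i.2 hext
  omega

theorem chain_mono {V : Type*} {r : ℕ} {g : V → ℕ} {w : ℕ → V}
    (hs : ∀ i < r, g (w i) < g (w (i+1))) :
    ∀ i j, i < j → j ≤ r → g (w i) < g (w j) := by
  intro i j hij hj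
  induction j, hij using Nat.le_induction with
  | base => exact hs i (by omega)
  | succ j hij ih => exact (ih (by omega)).trans (hs j (by omega))

theorem chain_inter {V K : Type*} [LinearOrder K] {k : V → K} (hk : Function.Injective k)
    {A : ℕ → Finset V} {w : ℕ → V} {r : ℕ} (h : IsCh k A w r)
    {i j : ℕ} (hij : i < j) (hj : j < r) {x : V} (hxi : x ∈ A i) (hxj : x ∈ A j) :
    x = w (i+1) ∧ x = w j := by
  have hm : ∀ j, i + 1 ≤ j → j < r → k (w (i+1)) ≤ k (w j) := by
    intro j hij
    induction j, hij using Nat.le_induction with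
    | base => intro _; exact le_rfl
    | succ j hij ih =>
      intro hj
      exact (ih (by omega)).trans ((h j (by omega)).2.2 _ (h j (by omega)).1 |>.2)
  have h1 := (h i (by omega)).2.2 x hxi
  have h2 := (h j hj).2.2 x hxj
  have h3 := hm j hij hj
  exact ⟨hk (le_antisymm h1.2 (h3.trans h2.1)), hk (le_antisymm (h1.2.trans h3) h2.1)⟩

theorem count_le {V ι : Type*} [Fintype V] [DecidableEq V] [Fintype ι]
    (N : ℕ) (hN : 0 < N) (U : ι → Finset V) (X : ι → Finset (Fin N))
    (hU : ∀ i j, i ≠ j → Disjoint (U i) (U j)) (S : Finset (V → Fin N))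
    (hS : ∀ f ∈ S, ∀ i, ∀ v ∈ U i, f v ∈ X i) :
    (S.card : ℝ) ≤ (N : ℝ) ^ Fintype.card V * ∏ i, ((X i).card / N : ℝ) ^ (U i).card := by
  classical
  have hN' : (0 : ℝ) < N := by exact_mod_cast hN
  let Y : V → Finset (Fin N) := fun v => univ.filter (fun x => ∀ i, v ∈ U i → x ∈ X i)
  have h1 : S ⊆ Fintype.piFinset Y := by
    intro f hf
    rw [Fintype.mem_piFinset]
    intro v
    simp only [Y, mem_filter, mem_univ, true_and]
    exact fun i hi => hS f hf i v hi
  have h2 : (S.card : ℝ) ≤ ∏ v, ((Y v).card : ℝ) := by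
    have := card_le_card h1
    rw [Fintype.card_piFinset] at this
    exact_mod_cast this
  have h3 : ∏ v, ((Y v).card : ℝ) = (N : ℝ) ^ Fintype.card V * ∏ v, ((Y v).card / N : ℝ) := by
    rw [prod_div_distrib, prod_const, card_univ]
    field_simp
  have hY1 : ∀ v, ((Y v).card / N : ℝ) ≤ 1 := by
    intro v
    rw [div_le_one hN']
    have := card_le_univ (Y v)
    rw [Fintype.card_fin] at this
    exact_mod_cast this
  rw [h3] at h2
  refine h2.trans (mul_le_mul_of_nonneg_left ?_ (by positivity))
  calc ∏ v, ((Y v).card / N : ℝ) ≤ ∏ v ∈ univ.biUnion U, ((Y v).card / N : ℝ) := by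
        rw [← prod_sdiff (subset_univ (univ.biUnion U))]
        exact mul_le_of_le_one_left (prod_nonneg fun v _ => by positivity)
          (prod_le_one (fun v _ => by positivity) (fun v _ => hY1 v))
    _ = ∏ i, ∏ v ∈ U i, ((Y v).card / N : ℝ) := by
        apply prod_biUnion
        intro i _ j _ hij
        exact hU i j hij
    _ ≤ ∏ i, ((X i).card / N : ℝ) ^ (U i).card := by
        apply prod_le_prod
        · intro i _
          exact prod_nonneg fun v _ => by positivity
        · intro i _
          rw [← prod_const]
          apply prod_le_prod
          · intro v _
            exact div_nonneg (Nat.cast_nonneg _) hN'.le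
          · intro v hv
            refine div_le_div_of_nonneg_right (Nat.cast_le.2 (card_le_card ?_)) hN'.le
            intro x hx
            simp only [Y, mem_filter, mem_univ, true_and] at hx
            exact hx i hv

theorem amgm (r : ℕ) (hr : 0 < r) (z : Fin r → ℝ) (hz : ∀ i, 0 ≤ z i) :
    ∏ i, z i ≤ ((∑ i, z i) / r) ^ r := by
  have hr' : (0 : ℝ) < r := by exact_mod_cast hr
  have h := Real.geom_mean_le_arith_mean univ (fun _ => (1:ℝ)) z (by simp) (by simpa using hr)
    (fun i _ => hz i)
  simp only [Real.rpow_one, sum_const, card_univ, Fintype.card_fin, nsmul_eq_mul, mul_one, one_mul] at h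
  have hp : 0 ≤ ∏ i, z i := prod_nonneg (fun i _ => hz i)
  calc ∏ i, z i = ((∏ i, z i) ^ ((r:ℝ)⁻¹)) ^ r := by
        rw [Real.rpow_inv_natCast_pow hp hr.ne']
    _ ≤ _ := by gcongr

theorem card_fin_Icc (N a b : ℕ) : 
    ((univ : Finset (Fin N)).filter (fun x : Fin N => a ≤ (x:ℕ) ∧ (x:ℕ) ≤ b)).card ≤ b + 1 - a := by
  rw [← Nat.card_Icc]
  apply card_le_card_of_injOn (fun x : Fin N => (x:ℕ))
  · intro x hx
    simpa using hx
  · intro x _ y _ h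
    exact Fin.ext h

theorem short_count {V : Type*} [Fintype V] [DecidableEq V] (n N L : ℕ) (hN : 0 < N)
    (A : Finset V) (hA : A.card = n) (S : Finset (V → Fin N))
    (hS : ∀ f ∈ S, ∃ u ∈ A, ∀ x ∈ A, (f u : ℕ) ≤ f x ∧ (f x : ℕ) ≤ f u + L) :
    (S.card : ℝ) ≤ (N : ℝ) ^ Fintype.card V * (n * ((L + 1 : ℝ) / N) ^ (n - 1)) := by
  classical
  have hN' : (0 : ℝ) < N := by exact_mod_cast hN
  let F : V × Fin N → Finset (V → Fin N) := fun p =>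
    S.filter (fun f => f p.1 = p.2 ∧ ∀ x ∈ A, (p.2 : ℕ) ≤ f x ∧ (f x : ℕ) ≤ p.2 + L)
  have hsub : S ⊆ (A ×ˢ (univ : Finset (Fin N))).biUnion F := by
    intro f hf
    obtain ⟨u, hu, h⟩ := hS f hf
    rw [mem_biUnion]
    exact ⟨(u, f u), by simp [hu], by simp only [F, mem_filter]; exact ⟨hf, trivial, h⟩⟩
  have hF : ∀ p ∈ A ×ˢ (univ : Finset (Fin N)), ((F p).card : ℝ) ≤
      (N : ℝ) ^ Fintype.card V * ((1 / N) * ((L + 1 : ℝ) / N) ^ (n - 1)) := by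
    rintro ⟨u, t⟩ hp
    have hu : u ∈ A := by simpa using hp
    have := count_le N hN (fun b : Bool => if b then {u} else A.erase u)
      (fun b : Bool => if b then {t} else
        univ.filter (fun x : Fin N => (t:ℕ) ≤ (x:ℕ) ∧ (x:ℕ) ≤ t + L))
      (by
        intro i j hij
        cases i <;> cases j <;> simp at hij ⊢) (F (u, t)) (by
        intro f hf b v hv
        simp only [F, mem_filter] at hf
        cases b
        · simp only [Bool.false_eq_true, if_false, mem_filter, mem_univ, true_and] at hv ⊢
          exact hf.2.2 v (mem_of_mem_erase hv)
        · simp only [if_true, mem_singleton] at hv ⊢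
          subst hv
          exact hf.2.1)
    refine this.trans ?_
    simp only [Fintype.prod_bool, if_true, card_singleton, pow_one, Bool.false_eq_true, if_false,
      card_erase_of_mem hu, hA, Nat.cast_one]
    gcongr
    have h := card_fin_Icc N t (t + L)
    have h' : (t : ℕ) + L + 1 - t = L + 1 := by omega
    rw [h'] at h
    exact_mod_cast h
  calc (S.card : ℝ) ≤ ∑ p ∈ A ×ˢ (univ : Finset (Fin N)), ((F p).card : ℝ) := by
        exact_mod_cast (card_le_card hsub).trans card_biUnion_le
    _ ≤ _ := sum_le_card_nsmul _ _ _ hF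
    _ = _ := by
        rw [card_product, hA, card_univ, Fintype.card_fin, nsmul_eq_mul]
        push_cast
        field_simp

theorem chain_count {V K : Type*} [Fintype V] [DecidableEq V] [LinearOrder K]
    (n N L s : ℕ) (hN : 0 < N)
    (k : (V → Fin N) → V → K) (hk : ∀ f, Function.Injective (k f))
    (hkm : ∀ f u x, k f u ≤ k f x → (f u : ℕ) ≤ f x)
    (a : ℕ → Finset V) (ha : ∀ i < s + 1, (a i).card = n) (S : Finset (V → Fin N))
    (hS : ∀ f ∈ S, ∃ w, IsCh (k f) a w (s+1) ∧ ∀ i < s + 1, (f (w i) : ℕ) + L < f (w (i+1))) :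
    (S.card : ℝ) ≤ (N : ℝ) ^ Fintype.card V *
      ((((N - (s+1) * L : ℕ) : ℝ) / N) ^ s * (((N + s : ℝ) / (N * (s+1))) ^ (s+1)) ^ (n - 2)) := by
  classical
  have hN' : (0 : ℝ) < N := by exact_mod_cast hN
  rcases S.eq_empty_or_nonempty with hSe | ⟨f0, hf0⟩
  · rw [hSe]
    simp only [card_empty, Nat.cast_zero]
    positivity
  obtain ⟨w, hw, hwl⟩ := hS f0 hf0
  have hmono := chain_mono (r := s+1) (g := fun v => (f0 v : ℕ)) (w := w)
    (fun i hi => by have := hwl i hi; omega)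
  have hwne : ∀ i j, i < j → j ≤ s + 1 → w i ≠ w j := by
    intro i j hij hj h
    have := hmono i j hij hj
    rw [h] at this
    exact lt_irrefl _ this
  -- the links are determined
  have hlink : ∀ f ∈ S, ∃ w', IsCh (k f) a w' (s+1) ∧
      (∀ i < s + 1, (f (w' i) : ℕ) + L < f (w' (i+1))) ∧ ∀ j, 1 ≤ j → j ≤ s → w' j = w j := by
    intro f hf
    obtain ⟨w', h1, h2⟩ := hS f hf
    refine ⟨w', h1, h2, ?_⟩
    intro j hj hjs
    obtain ⟨i, rfl⟩ : ∃ i, j = i + 1 := ⟨j - 1, by omega⟩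
    exact (chain_inter (hk f0) hw (Nat.lt_succ_self i) (by omega) (h1 i (by omega)).2.1
      (h1 (i+1) (by omega)).1).1
  let τ : (V → Fin N) → (Fin s → Fin N) := fun f j => f (w (j + 1))
  let R : Finset (Fin s → Fin N) := Fintype.piFinset fun j : Fin s =>
    univ.filter (fun x : Fin N => (j + 1) * L ≤ (x : ℕ) ∧ (x : ℕ) ≤ N - 1 - (s - j) * L)
  have hτ : ∀ f ∈ S, τ f ∈ R := by
    intro f hf
    obtain ⟨w', h1, h2, h3⟩ := hlink f hf
    have hlo : ∀ i, i ≤ s + 1 → i * L ≤ f (w' i) := by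
      intro i
      induction i with
      | zero => intro _; simp
      | succ i ih =>
        intro hi
        have h4 := ih (by omega)
        have h5 := h2 i (by omega)
        rw [Nat.succ_mul]; omega
    have hhi : ∀ d i, i + d = s + 1 → f (w' i) + d * L ≤ f (w' (s+1)) := by
      intro d
      induction d with
      | zero => intro i hi; simp at hi; subst hi; simp
      | succ d ih =>
        intro i hi
        have h4 := ih (i+1) (by omega)
        have h5 := h2 i (by omega)
        rw [Nat.succ_mul]; omega
    rw [Fintype.mem_piFinset]
    intro j
    simp only [mem_filter, mem_univ, true_and, τ]
    rw [← h3 (j+1) (by omega) (by omega)]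
    have h4 := hhi (s - j) (j + 1) (by omega)
    have h5 := (f (w' (s+1))).2
    exact ⟨hlo _ (by omega), by omega⟩
  have hR : (R.card : ℝ) ≤ ((N - (s+1) * L : ℕ) : ℝ) ^ s := by
    have : R.card ≤ (N - (s+1) * L) ^ s := by
      rw [Fintype.card_piFinset]
      calc _ ≤ ∏ j : Fin s, (N - (s+1) * L) := by
            apply prod_le_prod'
            intro j _
            refine (card_fin_Icc N _ _).trans ?_
            have e : (s + 1) * L = (j + 1) * L + (s - j) * L := by
              rw [← Nat.add_mul]; congr 1; omega
            rw [e]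
            have h0 : 1 * L ≤ (j + 1) * L := Nat.mul_le_mul_right _ (by omega)
            rcases Nat.eq_zero_or_pos L with hL | hL
            · subst hL; simp; omega
            · omega
        _ = _ := by simp
    exact_mod_cast this
  let T : (V → Fin N) → ℕ → ℕ := fun f i => if i = 0 then 0 else if i ≤ s then f (w i) else N - 1
  have hT : ∀ f ∈ S, ∀ i < s + 1, ∀ x ∈ a i, T f i ≤ f x ∧ (f x : ℕ) ≤ T f (i+1) := by
    intro f hf i hi x hx
    obtain ⟨w', h1, h2, h3⟩ := hlink f hf
    have h4 := (h1 i hi).2.2 x hx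
    have h5 := hkm f _ _ h4.1
    have h6 := hkm f _ _ h4.2
    constructor
    · by_cases h : i = 0
      · simp [T, h]
      · simp only [T, h, if_false, show i ≤ s by omega, if_true]
        rw [← h3 i (by omega) (by omega)]; exact h5
    · by_cases h : i + 1 ≤ s
      · simp only [T, Nat.succ_ne_zero, if_false, h, if_true]
        rw [← h3 (i+1) (by omega) h]; exact h6
      · simp only [T, Nat.succ_ne_zero, if_false, h]
        have := (f x).2; omega
  have hfib : ∀ t ∈ R, ((S.filter (fun f => τ f = t)).card : ℝ) ≤
      (N : ℝ) ^ Fintype.card V * ((1 / N) ^ s * (((N + s : ℝ) / (N * (s+1))) ^ (s+1)) ^ (n - 2)) := by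
    intro t _
    rcases (S.filter (fun f => τ f = t)).eq_empty_or_nonempty with he | ⟨f1, hf1⟩
    · rw [he]
      simp only [card_empty, Nat.cast_zero]
      positivity
    rw [mem_filter] at hf1
    obtain ⟨hf1S, rfl⟩ := hf1
    have hTeq : ∀ f, τ f = τ f1 → T f = T f1 := by
      intro f hf
      funext i
      simp only [T]
      split_ifs with h1 h2
      · rfl
      · obtain ⟨j, rfl⟩ : ∃ j, i = j + 1 := ⟨i - 1, by omega⟩
        have := congrFun hf ⟨j, by omega⟩
        simp only [τ] at this
        rw [this]
      · rfl
    have hTm : ∀ i < s + 1, T f1 i ≤ T f1 (i+1) := by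
      intro i hi
      have := hT f1 hf1S i hi (w i) (hw i hi).1
      omega
    let U : Fin s ⊕ Fin (s+1) → Finset V :=
      Sum.elim (fun j => {w (j+1)}) (fun i => ((a i).erase (w i)).erase (w (i+1)))
    let X : Fin s ⊕ Fin (s+1) → Finset (Fin N) :=
      Sum.elim (fun j => {f1 (w (j+1))})
        (fun i => univ.filter (fun x : Fin N => T f1 i ≤ (x:ℕ) ∧ (x:ℕ) ≤ T f1 (i+1)))
    have hD : ∀ i j : ℕ, i < j → j < s + 1 → ∀ x, x ∈ a i → x ∈ a j → x = w (i+1) ∧ x = w j :=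
      fun i j hij hj x h1 h2 => chain_inter (hk f0) hw hij hj h1 h2
    have hlr : ∀ (j : Fin s) (i : Fin (s+1)), Disjoint (U (Sum.inl j)) (U (Sum.inr i)) := by
      intro j i
      simp only [U, Sum.elim_inl, Sum.elim_inr, disjoint_singleton_left]
      intro hm
      simp only [mem_erase] at hm
      obtain ⟨h1, h2, h3⟩ := hm
      have h4 := (hw (j+1) (by omega)).1
      rcases lt_trichotomy (i:ℕ) (j+1) with h | h | h
      · exact h1 (hD i (j+1) h (by omega) _ h3 h4).1
      · exact h2 (by rw [h])
      · exact h2 (hD (j+1) i h (by omega) _ h4 h3).2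
    have hrr : ∀ (i j : Fin (s+1)), (i : ℕ) < j → Disjoint (U (Sum.inr i)) (U (Sum.inr j)) := by
      intro i j hij
      simp only [U, Sum.elim_inr]
      rw [disjoint_left]
      intro x hx hx'
      simp only [mem_erase] at hx hx'
      exact hx.1 (hD i j hij j.2 x hx.2.2 hx'.2.2).1
    have hdis : ∀ i j, i ≠ j → Disjoint (U i) (U j) := by
      rintro (i | i) (j | j) hij
      · simp only [U, Sum.elim_inl, disjoint_singleton_left, mem_singleton]
        have : (i : ℕ) ≠ j := fun h => hij (by rw [Fin.ext h])
        rcases lt_or_gt_of_ne this with h | h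
        · exact hwne _ _ (by omega) (by omega)
        · exact (hwne _ _ (by omega) (by omega)).symm
      · exact hlr i j
      · exact (hlr j i).symm
      · have : (i : ℕ) ≠ j := fun h => hij (by rw [Fin.ext h])
        rcases lt_or_gt_of_ne this with h | h
        · exact hrr _ _ h
        · exact (hrr _ _ h).symm
    have hcount := count_le N hN U X hdis (S.filter (fun f => τ f = τ f1)) (by
      intro f hf i v hv
      rw [mem_filter] at hf
      rcases i with j | i
      · simp only [U, X, Sum.elim_inl, mem_singleton] at hv ⊢
        rw [hv]
        exact congrFun hf.2 j
      · simp only [U, X, Sum.elim_inr, mem_erase, mem_filter, mem_univ, true_and] at hv ⊢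
        rw [← hTeq f hf.2]
        exact hT f hf.1 i i.2 v hv.2.2)
    refine hcount.trans (mul_le_mul_of_nonneg_left ?_ (by positivity))
    rw [Fintype.prod_sum_type]
    have hA : ∏ j : Fin s, ((X (Sum.inl j)).card / N : ℝ) ^ (U (Sum.inl j)).card = (1 / N) ^ s := by
      simp [X, U]
    have hUc : ∀ i : Fin (s+1), (U (Sum.inr i)).card = n - 2 := by
      intro i
      simp only [U, Sum.elim_inr]
      rw [card_erase_of_mem, card_erase_of_mem, ha i i.2]
      · omega
      · exact (hw i i.2).1
      · rw [mem_erase]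
        exact ⟨(hwne i (i+1) (by omega) (by omega)).symm, (hw i i.2).2.1⟩
    rw [hA]
    refine mul_le_mul_of_nonneg_left ?_ (by positivity)
    simp_rw [hUc]
    rw [prod_pow]
    refine pow_le_pow_left₀ (prod_nonneg fun i _ => by positivity) ?_ _
    refine (amgm (s+1) (by omega) (fun i => ((X (Sum.inr i)).card / N : ℝ))
      (fun i => by positivity)).trans ?_
    refine pow_le_pow_left₀ (div_nonneg (sum_nonneg fun i _ => by positivity) (by positivity)) ?_ _
    have hsum : ∑ i : Fin (s+1), ((X (Sum.inr i)).card : ℝ) ≤ N + s := by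
      calc ∑ i : Fin (s+1), ((X (Sum.inr i)).card : ℝ)
          ≤ ∑ i : Fin (s+1), (((T f1 (i+1) : ℝ) - T f1 i) + 1) := by
            apply sum_le_sum
            intro i _
            have h1 : (X (Sum.inr i)).card ≤ T f1 (i+1) + 1 - T f1 i := card_fin_Icc N _ _
            have h2 := hTm i i.2
            have h3 : (X (Sum.inr i)).card + T f1 i ≤ T f1 (i+1) + 1 := by omega
            have h4 : ((X (Sum.inr i)).card : ℝ) + T f1 i ≤ T f1 (i+1) + 1 := by exact_mod_cast h3
            linarith
        _ = (T f1 (s+1) : ℝ) - T f1 0 + (s + 1) := by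
            rw [sum_add_distrib, Fin.sum_univ_eq_sum_range (fun i => ((T f1 (i+1) : ℝ) - T f1 i)),
              sum_range_sub (fun i => (T f1 i : ℝ))]
            simp
        _ = N + s := by
            simp only [T, Nat.succ_ne_zero, if_false, if_true,
              show ¬ (s + 1 ≤ s) by omega]
            rw [Nat.cast_sub hN]
            push_cast
            ring
    rw [← sum_div, div_div]
    push_cast
    gcongr
  calc (S.card : ℝ) = ∑ t ∈ R, ((S.filter (fun f => τ f = t)).card : ℝ) := by
        rw [card_eq_sum_card_fiberwise (f := τ) (t := R) (fun f hf => hτ f hf)]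
        push_cast; rfl
    _ ≤ _ := sum_le_card_nsmul _ _ _ hfib
    _ ≤ ((N - (s+1) * L : ℕ) : ℝ) ^ s * ((N : ℝ) ^ Fintype.card V *
          ((1 / N) ^ s * (((N + s : ℝ) / (N * (s+1))) ^ (s+1)) ^ (n - 2))) := by
        rw [nsmul_eq_mul]
        gcongr
    _ = _ := by
        rw [div_pow ((N - (s+1) * L : ℕ) : ℝ) (N:ℝ) s, one_div_pow]
        ring

theorem core_ineq {V : Type*} [Fintype V] (n N L s : ℕ) (hn : 0 < n) (hN : 0 < N)
    (E : Finset (Finset V)) (hE : ∀ A ∈ E, A.card = n)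
    (hcol : ∀ c : V → Fin (s+1), ∃ A ∈ E, ∃ i : Fin (s+1), ∀ v ∈ A, c v = i) :
    1 ≤ (E.card : ℝ) * (n * ((L + 1 : ℝ) / N) ^ (n - 1)) + (E.card : ℝ) ^ (s+1) *
      ((((N - (s+1) * L : ℕ) : ℝ) / N) ^ s * (((N + s : ℝ) / (N * (s+1))) ^ (s+1)) ^ (n - 2)) := by
  classical
  have hN' : (0 : ℝ) < N := by exact_mod_cast hN
  let e := Fintype.equivFin V
  let k : (V → Fin N) → V → (ℕ ×ₗ Fin (Fintype.card V)) := fun f v => toLex ((f v : ℕ), e v)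
  have hk : ∀ f, Function.Injective (k f) := by
    intro f u v h
    have h' := congrArg (fun z => (ofLex z).2) h
    exact e.injective h'
  have hkm : ∀ f u x, k f u ≤ k f x → (f u : ℕ) ≤ f x := by
    intro f u x h
    rcases (Prod.Lex.toLex_le_toLex.1 h) with h | h
    · exact h.le
    · exact h.1.le
  let S1 : Finset V → Finset (V → Fin N) := fun A =>
    univ.filter (fun f => ∃ u ∈ A, ∀ x ∈ A, (f u : ℕ) ≤ f x ∧ (f x : ℕ) ≤ f u + L)
  let ext : (Fin (s+1) → Finset V) → ℕ → Finset V := fun a i =>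
    if h : i < s + 1 then a ⟨i, h⟩ else ∅
  let S2 : (Fin (s+1) → Finset V) → Finset (V → Fin N) := fun a =>
    univ.filter (fun f => ∃ w, IsCh (k f) (ext a) w (s+1) ∧
      ∀ i < s + 1, (f (w i) : ℕ) + L < f (w (i+1)))
  let Q : Finset (Fin (s+1) → Finset V) := Fintype.piFinset fun _ => E
  have hcover : (univ : Finset (V → Fin N)) ⊆ E.biUnion S1 ∪ Q.biUnion S2 := by
    intro f _
    obtain ⟨A, w, hA, hw⟩ := exists_chain (k f) E (s+1)
      (fun A hA => by rw [← card_pos, hE A hA]; exact hn) hcol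
    rw [mem_union]
    by_cases hlong : ∀ i < s + 1, (f (w i) : ℕ) + L < f (w (i+1))
    · right
      rw [mem_biUnion]
      refine ⟨fun i => A i, ?_, ?_⟩
      · rw [Fintype.mem_piFinset]
        exact fun i => hA i i.2
      · simp only [S2, mem_filter, mem_univ, true_and]
        refine ⟨w, ?_, hlong⟩
        intro i hi
        simp only [ext, hi, dif_pos]
        exact hw i hi
    · left
      push Not at hlong
      obtain ⟨i, hi, hl⟩ := hlong
      rw [mem_biUnion]
      refine ⟨A i, hA i hi, ?_⟩
      simp only [S1, mem_filter, mem_univ, true_and]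
      refine ⟨w i, (hw i hi).1, fun x hx => ?_⟩
      have h := (hw i hi).2.2 x hx
      exact ⟨hkm f _ _ h.1, (hkm f _ _ h.2).trans hl⟩
  have hc : ((N : ℝ) ^ Fintype.card V) ≤
      ∑ A ∈ E, ((S1 A).card : ℝ) + ∑ a ∈ Q, ((S2 a).card : ℝ) := by
    have h := (card_le_card hcover).trans ((card_union_le _ _).trans
      (add_le_add card_biUnion_le card_biUnion_le))
    rw [card_univ, Fintype.card_fun, Fintype.card_fin] at h
    exact_mod_cast h
  have h1 : ∑ A ∈ E, ((S1 A).card : ℝ) ≤ _ := sum_le_card_nsmul _ _ _ (fun A hA =>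
    short_count n N L hN A (hE A hA) (S1 A) (fun f hf => by simpa [S1] using hf))
  have h2 : ∑ a ∈ Q, ((S2 a).card : ℝ) ≤ _ := sum_le_card_nsmul _ _ _ (fun a ha =>
    chain_count n N L s hN k hk hkm (ext a) (fun i hi => by
      simp only [ext, hi, dif_pos]
      exact hE _ (Fintype.mem_piFinset.1 ha _)) (S2 a) (fun f hf => by
        simpa only [S2, mem_filter, mem_univ, true_and] using hf))
  have hQ : (Q.card : ℝ) = (E.card : ℝ) ^ (s+1) := by
    simp [Q, Fintype.card_piFinset]
  rw [nsmul_eq_mul] at h1 h2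
  rw [hQ] at h2
  have hp : (0 : ℝ) < (N : ℝ) ^ Fintype.card V := by positivity
  have h3 := hc.trans (add_le_add h1 h2)
  refine le_of_mul_le_mul_left ?_ hp
  rw [mul_one]
  refine h3.trans (le_of_eq ?_)
  ring

set_option maxHeartbeats 1000000 in
theorem final_bound {V : Type*} [Fintype V] (n s : ℕ) (hs : 1 ≤ s)
    (hl1 : 1 ≤ Real.log n) (hl2 : 4 * Real.log n ≤ n)
    (E : Finset (Finset V)) (hE : ∀ A ∈ E, A.card = n)
    (hcol : ∀ c : V → Fin (s+1), ∃ A ∈ E, ∃ i : Fin (s+1), ∀ v ∈ A, c v = i)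
    (y : ℝ) (hy0 : 0 ≤ y) (hyn : y ≤ n) (hys : y ^ (s+1) ≤ ((n : ℝ) / Real.log n) ^ s) :
    Real.exp (-4 * ((s+1 : ℕ) : ℝ) ^ 2) * y * ((s+1 : ℕ) : ℝ) ^ n ≤ E.card := by
  set l := Real.log n with hl
  set r : ℝ := ((s+1 : ℕ) : ℝ) with hr
  have hrs : r = s + 1 := by rw [hr]; push_cast; ring
  have hr2 : 2 ≤ r := by
    have : (1:ℝ) ≤ s := by exact_mod_cast hs
    linarith
  have hr0 : 0 < r := by linarith
  have hnR : (4:ℝ) ≤ n := by linarith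
  have hn4 : 4 ≤ n := by exact_mod_cast hnR
  have hn0 : (0:ℝ) < n := by linarith
  by_contra hcon
  push Not at hcon
  set c := Real.exp (-4 * r ^ 2) with hc
  have hc0 : 0 < c := Real.exp_pos _
  set m : ℝ := (E.card : ℝ) with hm
  have hm0 : 0 ≤ m := Nat.cast_nonneg _
  let N : ℕ := (s+1) * n
  have hNR : (N : ℝ) = r * n := by simp [N, hr]
  have hN : 0 < N := by positivity
  let L : ℕ := ⌈(n : ℝ) - 4 * l⌉₊
  have hL1 : (n : ℝ) - 4 * l ≤ L := Nat.le_ceil _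
  have hL2 : (L : ℝ) < n - 4 * l + 1 := Nat.ceil_lt_add_one (by linarith)
  have hLn : L ≤ n := Nat.ceil_le.2 (by linarith)
  have key := core_ineq n N L s (by omega) hN E hE hcol
  -- first factor
  have f1 : ((L + 1 : ℝ) / N) ^ (n - 1) ≤ (1 / r) ^ (n - 1) * (Real.exp 1 / n ^ 2) := by
    have h1 : (L + 1 : ℝ) / N ≤ (1 / r) * Real.exp (-(2 * l / n)) := by
      have h2 := Real.add_one_le_exp (-(2 * l / n))
      calc (L + 1 : ℝ) / N = (1 / r) * ((L + 1) / n) := by rw [hNR]; field_simp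
        _ ≤ (1 / r) * (-(2 * l / n) + 1) := by
          apply mul_le_mul_of_nonneg_left _ (by positivity)
          rw [div_le_iff₀ hn0]
          have : (-(2 * l / n) + 1) * n = n - 2 * l := by field_simp; ring
          rw [this]; linarith
        _ ≤ _ := by gcongr
    calc _ ≤ ((1 / r) * Real.exp (-(2 * l / n))) ^ (n - 1) := by
          apply pow_le_pow_left₀ (by positivity) h1
      _ = (1 / r) ^ (n - 1) * Real.exp (-(2 * l / n)) ^ (n - 1) := mul_pow _ _ _
      _ ≤ _ := by
        apply mul_le_mul_of_nonneg_left _ (by positivity)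
        rw [← Real.exp_nat_mul, Nat.cast_sub (by omega : 1 ≤ n)]
        have h3 : (n : ℝ) ^ 2 = Real.exp (2 * l) := by
          rw [two_mul, Real.exp_add, hl, Real.exp_log hn0, sq]
        rw [h3, ← Real.exp_sub]
        apply Real.exp_le_exp.2
        have h4 : ((n : ℝ) - (1 : ℕ)) * -(2 * l / n) = 2 * l / n - 2 * l := by
          push_cast; field_simp; ring
        rw [h4]
        have : 2 * l / n ≤ 1 := by rw [div_le_one hn0]; linarith
        linarith
  have f2 : (((N - (s+1) * L : ℕ) : ℝ) / N) ^ s ≤ (4 * l / n) ^ s := by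
    apply pow_le_pow_left₀ (by positivity)
    have h1 : N - (s+1) * L = (s+1) * (n - L) := (Nat.mul_sub _ _ _).symm
    rw [h1, hNR, Nat.cast_mul, ← hr, Nat.cast_sub hLn, mul_div_mul_left _ _ hr0.ne']
    gcongr
    linarith
  have f3 : (((N + s : ℝ) / (N * (s+1))) ^ (s+1)) ^ (n - 2) ≤
      ((1 / r) ^ (n - 2) * Real.exp 1) ^ (s + 1) := by
    rw [← pow_mul, mul_comm (s+1), pow_mul]
    apply pow_le_pow_left₀ (by positivity)
    have h1 : (N + s : ℝ) / (N * (s+1)) ≤ (1 / r) * Real.exp (1 / n) := by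
      have h2 := Real.add_one_le_exp (1 / (n:ℝ))
      calc (N + s : ℝ) / (N * (s+1)) = (1 / r) * ((N + s) / N) := by
            rw [← hrs]; field_simp
        _ ≤ (1 / r) * (1 / n + 1) := by
          apply mul_le_mul_of_nonneg_left _ (by positivity)
          rw [hNR, div_le_iff₀ (by positivity)]
          have : (1 / (n:ℝ) + 1) * (r * n) = r + r * n := by field_simp
          rw [this]; linarith
        _ ≤ _ := by gcongr
    calc _ ≤ ((1 / r) * Real.exp (1 / n)) ^ (n - 2) := by
          apply pow_le_pow_left₀ (by positivity) h1
      _ = (1 / r) ^ (n - 2) * Real.exp (1 / n) ^ (n - 2) := mul_pow _ _ _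
      _ ≤ _ := by
        apply mul_le_mul_of_nonneg_left _ (by positivity)
        rw [← Real.exp_nat_mul, Nat.cast_sub (by omega : 2 ≤ n)]
        apply Real.exp_le_exp.2
        rw [mul_one_div, div_le_one hn0]
        push_cast; linarith
  have hpow1 : r ^ n * (1 / r) ^ (n - 1) = r := by
    obtain ⟨k, rfl⟩ : ∃ k, n = k + 1 := ⟨n - 1, by omega⟩
    rw [Nat.add_sub_cancel, pow_succ, one_div_pow]
    field_simp
  have hpow2 : r ^ n * (1 / r) ^ (n - 2) = r ^ 2 := by
    obtain ⟨k, rfl⟩ : ∃ k, n = k + 2 := ⟨n - 2, by omega⟩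
    rw [Nat.add_sub_cancel, pow_add, one_div_pow]
    field_simp
  have he : Real.exp 1 < 2.72 := by linarith [Real.exp_one_lt_d9]
  have he0 : 0 < Real.exp 1 := Real.exp_pos _
  -- constant
  have hconst : c * 4 * r ^ 2 * Real.exp 1 ≤ 1 / 4 := by
    have h1 := Real.pow_div_factorial_le_exp (4 * r ^ 2) (by positivity) 3
    have h2 : c * Real.exp (4 * r ^ 2) = 1 := by
      rw [hc, ← Real.exp_add]; simp
    have h16 : 16 ≤ 4 * r ^ 2 := by nlinarith
    set u := 4 * r ^ 2 with hu
    have h3 : c * (u ^ 3 / 6) ≤ 1 := by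
      rw [← h2]
      apply mul_le_mul_of_nonneg_left _ hc0.le
      simpa [Nat.factorial] using h1
    have h4 : c * u * 256 ≤ c * u * u ^ 2 := by
      apply mul_le_mul_of_nonneg_left _ (by positivity)
      calc (256:ℝ) = 16 ^ 2 := by norm_num
        _ ≤ u ^ 2 := pow_le_pow_left₀ (by norm_num) h16 2
    have h7 : c * u * u ^ 2 = 6 * (c * (u ^ 3 / 6)) := by ring
    have h5 : c * u * 256 ≤ 6 := by linarith
    have h6 : c * 4 * r ^ 2 * Real.exp 1 = c * u * Real.exp 1 := by rw [hu]; ring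
    rw [h6]
    have h8 : 0 < c * u := by positivity
    have h9 : c * u * Real.exp 1 ≤ c * u * 2.72 := mul_le_mul_of_nonneg_left he.le h8.le
    linarith
  have hconst1 : c * r * Real.exp 1 ≤ 1 / 4 := by
    refine le_trans ?_ hconst
    apply mul_le_mul_of_nonneg_right _ he0.le
    rw [mul_assoc]
    apply mul_le_mul_of_nonneg_left _ hc0.le
    nlinarith
  have t1 : m * (n * ((L + 1 : ℝ) / N) ^ (n - 1)) ≤ 1 / 4 := by
    calc _ ≤ (c * y * r ^ n) * (n * ((1 / r) ^ (n - 1) * (Real.exp 1 / n ^ 2))) := by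
          gcongr
      _ = (c * Real.exp 1) * (r ^ n * (1 / r) ^ (n - 1)) * (y / n) := by
          field_simp
      _ = (c * r * Real.exp 1) * (y / n) := by rw [hpow1]; ring
      _ ≤ (c * r * Real.exp 1) * 1 := by
          apply mul_le_mul_of_nonneg_left _ (by positivity)
          rw [div_le_one hn0]; exact hyn
      _ ≤ _ := by linarith
  have t2 : m ^ (s+1) * ((((N - (s+1) * L : ℕ) : ℝ) / N) ^ s *
      (((N + s : ℝ) / (N * (s+1))) ^ (s+1)) ^ (n - 2)) ≤ 1 / 4 := by
    have h4l : (4 * l / n : ℝ) ^ s = 4 ^ s * (l / n) ^ s := by rw [← mul_pow]; ring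
    calc _ ≤ (c * y * r ^ n) ^ (s+1) * ((4 * l / n) ^ s *
          ((1 / r) ^ (n - 2) * Real.exp 1) ^ (s + 1)) := by
          gcongr
      _ = (y ^ (s+1) * (l / n) ^ s) * 4 ^ s *
          (c * (r ^ n * (1 / r) ^ (n - 2)) * Real.exp 1) ^ (s+1) := by
          rw [h4l]; simp only [mul_pow]; ring
      _ ≤ 1 * 4 ^ (s+1) * (c * (r ^ n * (1 / r) ^ (n - 2)) * Real.exp 1) ^ (s+1) := by
          have h1 : y ^ (s+1) * (l / n) ^ s ≤ 1 := by
            calc _ ≤ (n / l) ^ s * (l / n) ^ s := by gcongr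
              _ = 1 := by
                rw [← mul_pow]
                have : (n / l) * (l / n) = 1 := by
                  have : l ≠ 0 := by linarith
                  field_simp
                rw [this, one_pow]
          have h2 : (4:ℝ) ^ s ≤ 4 ^ (s+1) := pow_le_pow_right₀ (by norm_num) (by omega)
          gcongr
      _ = (c * 4 * r ^ 2 * Real.exp 1) ^ (s+1) := by
          rw [hpow2, one_mul, ← mul_pow]; ring
      _ ≤ (1 / 4) ^ (s+1) := by gcongr
      _ ≤ 1 / 4 := pow_le_of_le_one (by norm_num) (by norm_num) (by omega)
  linarith

end Aux


/-- Kostochka's bound: for every `C > 0` there is `n₀` such that for all `n ≥ n₀` and all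
`r` with `2 ≤ r ≤ C·√(ln ln n)`, every `n`-uniform hypergraph with chromatic number
greater than `r` has at least `e^{−4r²} · (n / ln n)^{a/(a+1)} · r^n` edges, where
`a = ⌊log₂ r⌋`. -/
theorem stmt_12 (C : ℝ) (hC : 0 < C) :
    ∃ n₀ : ℕ, ∀ n ≥ n₀, ∀ r : ℕ, 2 ≤ r →
      (r : ℝ) ≤ C * Real.sqrt (Real.log (Real.log n)) →
      ∀ (V : Type) [Fintype V] [DecidableEq V] (E : Finset (Finset V)),
        (∀ A ∈ E, A.card = n) →
        (∀ c : V → Fin r, ∃ A ∈ E, ∃ i : Fin r, ∀ v ∈ A, c v = i) →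
        (E.card : ℝ) ≥
          Real.exp (-4 * (r : ℝ) ^ 2) *
            ((n : ℝ) / Real.log n) ^ ((Nat.log 2 r : ℝ) / ((Nat.log 2 r : ℝ) + 1)) *
            (r : ℝ) ^ n := by
  have hev : ∀ᶠ n : ℕ in Filter.atTop, 1 ≤ Real.log n ∧ 4 * Real.log n ≤ n := by
    have h1 : ∀ᶠ x : ℝ in Filter.atTop, 1 ≤ Real.log x :=
      Real.tendsto_log_atTop.eventually_ge_atTop 1
    have h2 : ∀ᶠ x : ℝ in Filter.atTop, 4 * Real.log x ≤ x := by
      have h := Real.isLittleO_log_id_atTop.bound (show (0:ℝ) < 1 / 4 by norm_num)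
      filter_upwards [h, Filter.eventually_ge_atTop 0] with x hx hx0
      have h3 := (Real.le_norm_self _).trans hx
      simp only [id, Real.norm_eq_abs, abs_of_nonneg hx0] at h3
      linarith
    exact tendsto_natCast_atTop_atTop.eventually (h1.and h2)
  obtain ⟨n₀, hn₀⟩ := Filter.eventually_atTop.1 hev
  refine ⟨n₀, ?_⟩
  intro n hn r hr _ V _ _ E hE hcol
  obtain ⟨hl1, hl2⟩ := hn₀ n hn
  obtain ⟨s, rfl⟩ : ∃ s, r = s + 1 := ⟨r - 1, by omega⟩
  have hl0 : 0 < Real.log n := by linarith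
  have hx1 : 1 ≤ (n : ℝ) / Real.log n := by rw [one_le_div hl0]; linarith
  have hx0 : 0 ≤ (n : ℝ) / Real.log n := by linarith
  have hxn : (n : ℝ) / Real.log n ≤ n := div_le_self (Nat.cast_nonneg _) hl1
  set a := Nat.log 2 (s+1) with ha
  have has : a ≤ s := by
    have := Nat.log_lt_self 2 (x := s + 1) (by omega)
    omega
  have hasR : (a : ℝ) ≤ s := by exact_mod_cast has
  have ha0 : (0:ℝ) ≤ a := Nat.cast_nonneg _
  have hexp : (a : ℝ) / (a + 1) ≤ s / (s + 1) := by
    rw [div_le_div_iff₀ (by positivity) (by positivity)]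
    nlinarith
  refine final_bound n s (by omega) hl1 hl2 E hE hcol _ (Real.rpow_nonneg hx0 _) ?_ ?_
  · refine le_trans ?_ hxn
    calc _ ≤ ((n : ℝ) / Real.log n) ^ (1:ℝ) := by
          apply Real.rpow_le_rpow_of_exponent_le hx1
          rw [div_le_one (by positivity)]; linarith
      _ = _ := Real.rpow_one _
  · rw [← Real.rpow_natCast, ← Real.rpow_mul hx0, ← Real.rpow_natCast]
    apply Real.rpow_le_rpow_of_exponent_le hx1
    push_cast
    calc (a : ℝ) / (a + 1) * (s + 1) ≤ s / (s + 1) * (s + 1) := by gcongr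
      _ = s := by field_simp
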